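/- Let U be a unitary operator on a complex Hilbert space H and Γ a unitary involution on H with ΓUΓ = U⁻¹; set C := ΓU (a unitary involution), Q := (U − U*)/(2i), Γ₋ := (1 − Γ)/2, and C± := (1 ± C)/2. If φ ∈ H satisfies Γφ = φ and Γ₋Qφ = 0 (i.e., φ ∈ ker α), then U C₊ φ = C₊ φ and U C₋ φ = −C₋ φ. -/

import Mathlib

open ContinuousLinearMap

/-- Let `U` be unitary with chiral symmetry `Γ U Γ = U⁻¹ = U*`, `C = Γ U`,
`Q = (U - U*)/(2i)`, `Γ₋ = (1 - Γ)/2`, and `C± = (1 ± C)/2`.  If `φ ∈ ker α`, i.e.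
`Γ φ = φ` and `Γ₋ Q φ = 0`, then `U C₊ φ = C₊ φ` and `U C₋ φ = -C₋ φ`. -/
theorem stmt17 {H : Type*} [NormedAddCommGroup H] [InnerProductSpace ℂ H] [CompleteSpace H]
    (U Γ : H →L[ℂ] H) (hU : U ∈ unitary (H →L[ℂ] H))
    (hΓu : Γ ∈ unitary (H →L[ℂ] H)) (hΓ2 : Γ * Γ = 1) (hchiral : Γ * U * Γ = star U)
    (φ : H) (h1 : Γ φ = φ)
    (h2 : ((2:ℂ)⁻¹ • (1 - Γ) : H →L[ℂ] H) (((2 * Complex.I)⁻¹ • (U - star U) : H →L[ℂ] H) φ)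
      = 0) :
    U (((2:ℂ)⁻¹ • (1 + Γ * U) : H →L[ℂ] H) φ) = ((2:ℂ)⁻¹ • (1 + Γ * U) : H →L[ℂ] H) φ ∧
    U (((2:ℂ)⁻¹ • (1 - Γ * U) : H →L[ℂ] H) φ) = -(((2:ℂ)⁻¹ • (1 - Γ * U) : H →L[ℂ] H) φ) := by
  have hstar : star U φ = Γ (U φ) := by
    rw [← hchiral]
    simp [h1]
  have hUU : U (Γ (U φ)) = φ := by
    rw [← hstar, ← mul_apply_eq_comp, Unitary.mul_star_self_of_mem hU, one_apply_eq_self]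
  have hΓΓ : Γ (Γ (U φ)) = U φ := by
    rw [← mul_apply_eq_comp, hΓ2, one_apply_eq_self]
  have hfix : Γ (U φ) = U φ := by
    simp only [smul_apply, sub_apply, one_apply_eq_self, map_smul, map_sub, hstar, hΓΓ, ← smul_sub,
      smul_eq_zero, inv_eq_zero, mul_eq_zero, Complex.I_ne_zero, OfNat.ofNat_ne_zero,
      false_or, or_false] at h2
    have h : (2 : ℂ) • (U φ - Γ (U φ)) = 0 := by
      rw [← h2]
      module
    exact (sub_eq_zero.mp ((smul_eq_zero_iff_right two_ne_zero).mp h)).symm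
  rw [hfix] at hUU
  simp only [smul_apply, add_apply, sub_apply, one_apply_eq_self, mul_apply_eq_comp, map_smul, map_add,
    map_sub, hfix, hUU]
  constructor <;> module
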